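/- The polynomial part of the restricted partition function is given by P_A(t) = (1/(a_1⋯a_n)) * Σ_{m=0}^{n-1} [(-1)^m / (n-1-m)!] * Σ_{k_1+⋯+k_n = m} a_1^{k_1} ⋯ a_n^{k_n} * (B_{k_1} ⋯ B_{k_n}) / (k_1! ⋯ k_n!) * t^{n-1-m}, where B_k are the Bernoulli numbers. -/

import Mathlib

open PowerSeries

/-- The restricted partition function. -/
noncomputable def restrictedPartition (n : ℕ) (a : Fin n → ℕ) (t : ℕ) : ℕ :=
  Nat.card {m : Fin n → ℕ // ∑ i, m i * a i = t}

/-- The substitution `X ↦ exp (-X)`, sending a polynomial to a power series. -/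
noncomputable def substExpNeg : Polynomial ℂ →ₐ[ℂ] ℂ⟦X⟧ :=
  Polynomial.aeval (rescale (-1) (exp ℂ))

theorem substExpNeg_X : substExpNeg Polynomial.X = rescale (-1) (exp ℂ) :=
  Polynomial.aeval_X _

theorem constantCoeff_substExpNeg (p : Polynomial ℂ) :
    constantCoeff (substExpNeg p) = p.eval 1 := by
  rw [substExpNeg, Polynomial.aeval_def, Polynomial.hom_eval₂, Polynomial.eval,
    ← coeff_zero_eq_constantCoeff_apply, coeff_rescale]
  congr 1
  simp

theorem derivative_rescale_neg_one_exp :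
    d⁄dX ℂ (rescale (-1) (exp ℂ)) = -rescale (-1) (exp ℂ) := by
  ext n
  simp only [coeff_derivative, coeff_rescale, coeff_exp, map_neg, Nat.factorial_succ, eq_ratCast]
  push_cast
  have : (n.factorial : ℂ) ≠ 0 := by exact_mod_cast n.factorial_ne_zero
  have : (n + 1 : ℂ) ≠ 0 := by exact_mod_cast n.succ_ne_zero
  field_simp
  ring

theorem derivative_substExpNeg (p : Polynomial ℂ) :
    d⁄dX ℂ (substExpNeg p) = -substExpNeg (Polynomial.X * Polynomial.derivative p) := by
  rw [map_mul, substExpNeg_X, substExpNeg, Derivation.map_aeval, derivative_rescale_neg_one_exp,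
    smul_eq_mul]
  ring

theorem bernoulliPowerSeries_rescale_mul (c : ℂ) :
    rescale (-c) (bernoulliPowerSeries ℂ) * (1 - rescale (-c) (exp ℂ)) = C c * X := by
  have h := congrArg (rescale (-c)) (bernoulliPowerSeries_mul_exp_sub_one ℂ)
  rw [map_mul, map_sub, map_one, rescale_X, map_neg] at h
  linear_combination -h

theorem substExpNeg_one_sub_X_ne_zero :
    substExpNeg (1 - Polynomial.X) ≠ 0 := by
  intro h
  have := bernoulliPowerSeries_rescale_mul 1
  rw [map_sub, map_one, substExpNeg_X] at h
  rw [h, mul_zero, map_one, one_mul] at this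
  exact X_ne_zero this.symm

theorem substExpNeg_X_pow (k : ℕ) :
    substExpNeg (Polynomial.X ^ k) = rescale (-(k : ℂ)) (exp ℂ) := by
  rw [map_pow, substExpNeg_X, ← map_pow, exp_pow_eq_rescale_exp, rescale_rescale]
  simp

theorem mk_pow_succ_eq (j : ℕ) :
    (mk fun t : ℕ ↦ (t : ℂ) ^ (j + 1)) = X * d⁄dX ℂ (mk fun t : ℕ ↦ (t : ℂ) ^ j) := by
  ext t
  cases t with
  | zero => simp
  | succ t =>
    rw [coeff_succ_X_mul, coeff_derivative]
    simp [pow_succ]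

/-- After `X ↦ exp (-X)`, the generating function of `t ^ j` has principal part
`j! / X ^ (j + 1)`. -/
theorem exists_numerator_pow (j : ℕ) :
    ∃ (N : Polynomial ℂ) (H : ℂ⟦X⟧),
      (1 - X) ^ (j + 1) * (mk fun t : ℕ ↦ (t : ℂ) ^ j) = (N : ℂ⟦X⟧) ∧
      X ^ (j + 1) * substExpNeg N =
        substExpNeg (1 - Polynomial.X) ^ (j + 1) * (C (j.factorial : ℂ) + X ^ (j + 1) * H) := by
  induction j with
  | zero =>
    have hB : constantCoeff (rescale (-1) (bernoulliPowerSeries ℂ) - 1) = 0 := by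
      rw [← coeff_zero_eq_constantCoeff_apply, map_sub, coeff_rescale]
      simp [bernoulliPowerSeries]
    obtain ⟨H, hH⟩ := X_dvd_iff.mpr hB
    refine ⟨1, H, ?_, ?_⟩
    · simp only [zero_add, pow_one, pow_zero, Polynomial.coe_one]
      rw [mul_comm]
      exact mk_one_mul_one_sub_eq_one ℂ
    · have h := bernoulliPowerSeries_rescale_mul 1
      rw [map_one, one_mul] at h
      simp only [zero_add, pow_one, map_one, map_sub, substExpNeg_X, Nat.factorial_zero,
        Nat.cast_one]
      linear_combination (1 - rescale (-1) (exp ℂ)) * hH - h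
  | succ j ih =>
    obtain ⟨N, H, hN, hH⟩ := ih
    refine ⟨(1 - Polynomial.X) * (Polynomial.X * Polynomial.derivative N)
      + Polynomial.C (j + 1 : ℂ) * (Polynomial.X * N), -d⁄dX ℂ H, ?_, ?_⟩
    · have hd := congrArg (d⁄dX ℂ) hN
      rw [Derivation.leibniz, Derivation.leibniz_pow, derivative_coe, map_sub, derivative_one,
        derivative_X] at hd
      rw [mk_pow_succ_eq]
      simp only [smul_eq_mul, nsmul_eq_mul, Nat.add_sub_cancel] at hd
      have hC : ((Polynomial.C (j + 1 : ℂ) : Polynomial ℂ) : ℂ⟦X⟧) = j + 1 := by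
        rw [Polynomial.coe_C, map_add, map_natCast, map_one]
      rw [Polynomial.coe_add, Polynomial.coe_mul (Polynomial.C _), hC]
      push_cast at hd ⊢
      linear_combination (1 - X) * X * hd + (j + 1) * X * hN
    · have hd := congrArg (d⁄dX ℂ) hH
      simp only [Derivation.leibniz, Derivation.leibniz_pow, derivative_substExpNeg, map_add,
        derivative_X, smul_eq_mul, nsmul_eq_mul, Nat.add_sub_cancel,
        derivative_one, Derivation.map_natCast, Polynomial.derivative_X, map_mul,
        map_sub, map_one, map_natCast] at hd
      rw [Nat.factorial_succ]
      simp only [map_add, map_mul, map_sub, map_one, map_natCast, Nat.cast_mul] at hH ⊢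
      push_cast at hd hH ⊢
      linear_combination
        -(1 - substExpNeg Polynomial.X) * X * hd
          + (j + 1) * (1 - substExpNeg Polynomial.X + substExpNeg Polynomial.X * X) * hH

/-- After `X ↦ exp (-X)`, the principal part of the generating function of a polynomial `P` has
coefficients `j! * P.coeff j`. -/
theorem exists_numerator (P : Polynomial ℂ) (D : ℕ) (hD : P.natDegree < D) :
    ∃ (N : Polynomial ℂ) (K : ℂ⟦X⟧),
      (1 - X) ^ D * (mk fun t : ℕ ↦ P.eval (t : ℂ)) = (N : ℂ⟦X⟧) ∧
      X ^ D * substExpNeg N = substExpNeg (1 - Polynomial.X) ^ D * K ∧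
      ∀ j < D, coeff (D - 1 - j) K = P.coeff j * j.factorial := by
  choose N H hN hH using exists_numerator_pow
  refine ⟨∑ j ∈ Finset.range D, P.coeff j • ((1 - Polynomial.X) ^ (D - 1 - j) * N j),
    ∑ j ∈ Finset.range D, P.coeff j • (X ^ (D - 1 - j) * C (j.factorial : ℂ) + X ^ D * H j),
    ?_, ?_, ?_⟩
  · have hP : (mk fun t : ℕ ↦ P.eval (t : ℂ)) =
        ∑ j ∈ Finset.range D, P.coeff j • (mk fun t : ℕ ↦ (t : ℂ) ^ j) := by
      ext t
      simp [Polynomial.eval_eq_sum_range' hD]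
    rw [hP, Finset.mul_sum, ← Polynomial.coeToPowerSeries.ringHom_apply, map_sum]
    refine Finset.sum_congr rfl fun j hj ↦ ?_
    rw [Polynomial.coeToPowerSeries.ringHom_apply, Polynomial.coe_smul, Polynomial.coe_mul, ← hN]
    obtain ⟨e, rfl⟩ := Nat.exists_eq_add_of_lt (Finset.mem_range.mp hj)
    rw [show j + e + 1 - 1 - j = e by omega, mul_smul_comm]
    push_cast
    ring_nf
  · rw [map_sum, Finset.mul_sum, Finset.mul_sum]
    refine Finset.sum_congr rfl fun j hj ↦ ?_
    obtain ⟨e, rfl⟩ := Nat.exists_eq_add_of_lt (Finset.mem_range.mp hj)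
    rw [show j + e + 1 - 1 - j = e by omega, map_smul, mul_smul_comm, mul_smul_comm, map_mul,
      map_pow]
    congr 1
    linear_combination X ^ e * substExpNeg (1 - Polynomial.X) ^ e * hH j
  · intro j hj
    rw [map_sum, Finset.sum_eq_single_of_mem j (Finset.mem_range.mpr hj)]
    · have : ¬ D ≤ D - 1 - j := by omega
      simp [coeff_X_pow_mul', this]
    · intro i hi hij
      rw [Finset.mem_range] at hi
      have hlt : ¬ D ≤ D - 1 - j := by omega
      have hcoeff : coeff (D - 1 - j) (X ^ (D - 1 - i) * C (i.factorial : ℂ)) = 0 := by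
        rw [coeff_X_pow_mul', coeff_C]
        split_ifs <;> first | rfl | omega
      rw [coeff_smul, map_add, hcoeff, coeff_X_pow_mul', if_neg hlt, add_zero, smul_zero]

theorem exists_numerator_mul_pow (P : Polynomial ℂ) (D : ℕ) (hD : P.natDegree < D) (μ : ℂ) :
    ∃ N : Polynomial ℂ,
      (1 - C μ * X) ^ D * (mk fun t : ℕ ↦ P.eval (t : ℂ) * μ ^ t) = (N : ℂ⟦X⟧) := by
  obtain ⟨N, -, hN, -⟩ := exists_numerator P D hD
  refine ⟨N.comp (Polynomial.C μ * Polynomial.X), ?_⟩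
  have h := congrArg (rescale μ) hN
  rw [map_mul, map_pow, map_sub, map_one, rescale_X, rescale_mk] at h
  simp only [mul_comm _ (Polynomial.eval _ _)] at h
  rw [h]
  ext t
  rw [coeff_rescale, Polynomial.coeff_coe, Polynomial.coeff_coe, Polynomial.comp_C_mul_X_coeff,
    mul_comm]

theorem coeff_prod_antidiagonalTuple (n : ℕ) (f : Fin n → ℂ⟦X⟧) (d : ℕ) :
    coeff d (∏ i, f i) =
      ∑ k ∈ Finset.Nat.antidiagonalTuple n d, ∏ i, coeff (k i) (f i) := by
  rw [coeff_prod]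
  refine Finset.sum_bij' (fun l _ ↦ ⇑l) (fun k _ ↦ Finsupp.equivFunOnFinite.symm k)
    (fun l hl ↦ ?_) (fun k hk ↦ ?_) (fun l _ ↦ by ext; simp) (fun k _ ↦ by ext; simp)
    (fun l _ ↦ rfl)
  · simpa [Finset.Nat.mem_antidiagonalTuple] using hl
  · simpa [Finset.Nat.mem_antidiagonalTuple] using hk

theorem mk_dvd_mul_one_sub_X_pow (a : ℕ) (ha : 0 < a) :
    (mk fun k : ℕ ↦ if a ∣ k then (1 : ℂ) else 0) * (1 - X ^ a) = 1 := by
  ext k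
  rw [mul_sub, mul_one, map_sub, coeff_mul_X_pow', coeff_mk, coeff_one]
  by_cases h : a ≤ k
  · have : k ≠ 0 := by omega
    simp [h, this, Nat.dvd_sub_iff_left h dvd_rfl]
  · have : a ∣ k ↔ k = 0 :=
      ⟨fun hd ↦ Nat.eq_zero_of_dvd_of_lt hd (not_le.mp h), fun hk ↦ hk ▸ dvd_zero a⟩
    simp [h, this]

theorem mk_restrictedPartition (n : ℕ) (a : Fin n → ℕ) (ha : ∀ i, 0 < a i) :
    (mk fun t : ℕ ↦ (restrictedPartition n a t : ℂ)) =
      ∏ i, mk fun k : ℕ ↦ if a i ∣ k then (1 : ℂ) else 0 := by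
  ext t
  rw [coeff_prod_antidiagonalTuple]
  simp only [coeff_mk, Finset.prod_boole, Finset.mem_univ, true_imp_iff, Finset.sum_boole]
  rw [restrictedPartition, ← Fintype.card_coe, ← Nat.card_eq_fintype_card]
  refine congrArg Nat.cast (Nat.card_congr
    { toFun := fun m ↦ ⟨fun i ↦ m.1 i * a i, by
        simp [Finset.Nat.mem_antidiagonalTuple, m.2]⟩
      invFun := fun k ↦ ⟨fun i ↦ k.1 i / a i, ?_⟩
      left_inv := fun m ↦ Subtype.ext (funext fun i ↦ Nat.mul_div_cancel _ (ha i))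
      right_inv := fun k ↦ Subtype.ext (funext fun i ↦
        Nat.div_mul_cancel ((Finset.mem_filter.mp k.2).2 i)) })
  obtain ⟨hk, hdvd⟩ := Finset.mem_filter.mp k.2
  refine Eq.trans ?_ (Finset.Nat.mem_antidiagonalTuple.mp hk)
  exact Finset.sum_congr rfl fun i _ ↦ Nat.div_mul_cancel (hdvd i)

theorem mk_restrictedPartition_mul_prod (n : ℕ) (a : Fin n → ℕ) (ha : ∀ i, 0 < a i) :
    (mk fun t : ℕ ↦ (restrictedPartition n a t : ℂ)) * ∏ i, (1 - X ^ a i) = 1 := by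
  rw [mk_restrictedPartition n a ha, ← Finset.prod_mul_distrib]
  exact Finset.prod_eq_one fun i _ ↦ mk_dvd_mul_one_sub_X_pow (a i) (ha i)

theorem coeff_prod_rescale_bernoulliPowerSeries (n : ℕ) (a : Fin n → ℕ) (m : ℕ) :
    coeff m (∏ i, rescale (-(a i : ℂ)) (bernoulliPowerSeries ℂ)) =
      (-1) ^ m * ∑ k ∈ Finset.Nat.antidiagonalTuple n m,
        (∏ i, (a i : ℂ) ^ (k i)) * ∏ i, (bernoulli (k i) : ℂ) / (k i).factorial := by
  rw [coeff_prod_antidiagonalTuple, Finset.mul_sum]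
  refine Finset.sum_congr rfl fun k hk ↦ ?_
  rw [← Finset.Nat.mem_antidiagonalTuple.mp hk, ← Finset.prod_pow_eq_pow_sum,
    ← Finset.prod_mul_distrib, ← Finset.prod_mul_distrib]
  refine Finset.prod_congr rfl fun i _ ↦ ?_
  rw [coeff_rescale, neg_pow, bernoulliPowerSeries, coeff_mk]
  simp [mul_assoc]

theorem prod_rescale_bernoulliPowerSeries_mul (n : ℕ) (a : Fin n → ℕ) :
    (∏ i, rescale (-(a i : ℂ)) (bernoulliPowerSeries ℂ)) *
      substExpNeg (∏ i, (1 - Polynomial.X ^ a i)) = C (∏ i, (a i : ℂ)) * X ^ n := by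
  rw [map_prod, ← Finset.prod_mul_distrib]
  simp only [map_sub, map_one, substExpNeg_X_pow, bernoulliPowerSeries_rescale_mul,
    Finset.prod_mul_distrib, map_prod, Finset.prod_const, Finset.card_univ, Fintype.card_fin]

/-- The poles other than `1` of the generating function can be cleared by a polynomial not
vanishing at `1`. -/
theorem exists_clear_poles (P : ℂ → Polynomial ℂ) (T : Finset ℂ) (D : ℕ)
    (hD : ∀ μ ∈ T, (P μ).natDegree < D) (hT : 1 ∉ T) :
    ∃ Q R : Polynomial ℂ, Q.eval 1 ≠ 0 ∧
      (Q : ℂ⟦X⟧) * ∑ μ ∈ T, (mk fun t : ℕ ↦ (P μ).eval (t : ℂ) * μ ^ t) = (R : ℂ⟦X⟧) := by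
  classical
  refine ⟨∏ μ ∈ T, (1 - Polynomial.C μ * Polynomial.X) ^ D, ?_⟩
  choose! N hN using fun μ hμ ↦ exists_numerator_mul_pow (P μ) D (hD μ hμ) μ
  refine ⟨∑ μ ∈ T, (∏ ν ∈ T.erase μ, (1 - Polynomial.C ν * Polynomial.X) ^ D) * N μ, ?_, ?_⟩
  · rw [Polynomial.eval_prod, Finset.prod_ne_zero_iff]
    intro μ hμ
    simp only [Polynomial.eval_pow, Polynomial.eval_sub, Polynomial.eval_one, Polynomial.eval_mul,
      Polynomial.eval_C, Polynomial.eval_X, mul_one]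
    exact pow_ne_zero _ (sub_ne_zero.mpr fun h ↦ hT (h ▸ hμ))
  · rw [Finset.mul_sum, ← Polynomial.coeToPowerSeries.ringHom_apply (φ := ∑ μ ∈ T, _), map_sum]
    refine Finset.sum_congr rfl fun μ hμ ↦ ?_
    rw [← Finset.prod_erase_mul T _ hμ, Polynomial.coeToPowerSeries.ringHom_apply,
      Polynomial.coe_mul, Polynomial.coe_mul, ← hN μ hμ]
    push_cast
    ring

theorem prod_mul_coeff_mul_factorial (n : ℕ) (a : Fin n → ℕ) (ha : ∀ i, 0 < a i)
    (P : ℂ → Polynomial ℂ) (T : Finset ℂ) (D : ℕ) (hD : ∀ μ, (P μ).natDegree < D) (hT : 1 ∈ T)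
    (hdecomp : ∀ t : ℕ, (restrictedPartition n a t : ℂ) =
      ∑ μ ∈ T, (P μ).eval (t : ℂ) * μ ^ t) (j : ℕ) (hj : j < D) :
    (∏ i, (a i : ℂ)) * ((P 1).coeff j * j.factorial) =
      coeff (D - 1 - j + n)
        (X ^ D * ∏ i, rescale (-(a i : ℂ)) (bernoulliPowerSeries ℂ)) := by
  classical
  obtain ⟨Q, R, hQ, hR⟩ := exists_clear_poles P (T.erase 1) D (fun μ _ ↦ hD μ)
    (Finset.notMem_erase 1 T)
  obtain ⟨N, K, hN, hK, hcoeff⟩ := exists_numerator (P 1) D (hD 1)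
  have hF : (mk fun t : ℕ ↦ (restrictedPartition n a t : ℂ)) =
      (∑ μ ∈ T.erase 1, mk fun t : ℕ ↦ (P μ).eval (t : ℂ) * μ ^ t) +
        mk fun t : ℕ ↦ (P 1).eval (t : ℂ) := by
    ext t
    simp [hdecomp, ← Finset.sum_erase_add T _ hT]
  have hprod := mk_restrictedPartition_mul_prod n a ha
  rw [hF] at hprod
  set W : Polynomial ℂ := ∏ i, (1 - Polynomial.X ^ a i) with hW
  have hWcoe : (W : ℂ⟦X⟧) = ∏ i, (1 - X ^ a i) := by
    rw [hW, ← Polynomial.coeToPowerSeries.ringHom_apply, map_prod]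
    simp
  have hpoly : Q * ((1 - Polynomial.X) ^ D - N * W) = R * W * (1 - Polynomial.X) ^ D := by
    apply Polynomial.coe_injective ℂ
    push_cast
    rw [← hN, ← hR, hWcoe]
    linear_combination -(Q : ℂ⟦X⟧) * (1 - X) ^ D * hprod
  have hsub := congrArg substExpNeg hpoly
  simp only [map_mul, map_sub, map_pow] at hsub
  rw [← map_sub] at hsub
  have hw : substExpNeg (1 - Polynomial.X) ^ D ≠ 0 := pow_ne_zero _ substExpNeg_one_sub_X_ne_zero
  have hcancel : substExpNeg Q * (X ^ D - K * substExpNeg W) =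
      substExpNeg R * substExpNeg W * X ^ D := by
    apply mul_left_cancel₀ hw
    linear_combination X ^ D * hsub + substExpNeg Q * substExpNeg W * hK
  have hinv : (substExpNeg Q)⁻¹ * substExpNeg Q = 1 :=
    PowerSeries.inv_mul_cancel _ (by rwa [constantCoeff_substExpNeg])
  have hB := prod_rescale_bernoulliPowerSeries_mul n a
  rw [← hW] at hB
  have hfinal : X ^ D * ∏ i, rescale (-(a i : ℂ)) (bernoulliPowerSeries ℂ) =
      C (∏ i, (a i : ℂ)) * ((K + X ^ D * ((substExpNeg Q)⁻¹ * substExpNeg R)) * X ^ n) := by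
    set B := ∏ i, rescale (-(a i : ℂ)) (bernoulliPowerSeries ℂ)
    linear_combination (substExpNeg Q)⁻¹ * B * hcancel
      + (K + X ^ D * ((substExpNeg Q)⁻¹ * substExpNeg R)) * hB
      - (X ^ D - K * substExpNeg W) * B * hinv
  rw [hfinal, coeff_C_mul, coeff_mul_X_pow, map_add, hcoeff j hj, coeff_X_pow_mul',
    if_neg (by omega), add_zero]

/-- Explicit formula for the polynomial part of the restricted partition function:
`P_A(t) = (1/(a_1⋯a_n)) ∑_{m=0}^{n-1} [(-1)^m/(n-1-m)!]
  ∑_{k_1+⋯+k_n=m} a_1^{k_1}⋯a_n^{k_n} (B_{k_1}⋯B_{k_n})/(k_1!⋯k_n!) t^{n-1-m}`. -/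
theorem polynomialPart_explicit_formula (n : ℕ) (hn : 0 < n) (a : Fin n → ℕ)
    (ha : ∀ i, 0 < a i)
    (P : ℂ → Polynomial ℂ)
    (hsupp : ∀ μ : ℂ, P μ ≠ 0 → ∃ i, μ ^ (a i) = 1)
    (hdecomp : ∀ t : ℕ, (restrictedPartition n a t : ℂ) =
      ∑ᶠ μ : ℂ, (P μ).eval (t : ℂ) * μ ^ t)
    (t : ℕ) :
    (P 1).eval (t : ℂ) =
      (∏ i, (a i : ℂ))⁻¹ *
        ∑ m ∈ Finset.range n, (-1) ^ m / (n - 1 - m).factorial *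
          (∑ k ∈ Finset.Nat.antidiagonalTuple n m,
            (∏ i, (a i : ℂ) ^ (k i)) *
              ∏ i, (bernoulli (k i) : ℂ) / (k i).factorial) *
          (t : ℂ) ^ (n - 1 - m) := by
  classical
  have ha' : ∏ i, (a i : ℂ) ≠ 0 :=
    Finset.prod_ne_zero_iff.mpr fun i _ ↦ by exact_mod_cast (ha i).ne'
  have hfin : {μ : ℂ | P μ ≠ 0}.Finite := by
    refine (Set.finite_iUnion fun i ↦
      (Polynomial.nthRootsFinset (a i) (1 : ℂ)).finite_toSet).subset fun μ hμ ↦ ?_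
    obtain ⟨i, hi⟩ := hsupp μ hμ
    exact Set.mem_iUnion.mpr ⟨i, (Polynomial.mem_nthRootsFinset (ha i) 1).mpr hi⟩
  set T : Finset ℂ := insert 1 hfin.toFinset
  have hPT : ∀ μ ∉ T, P μ = 0 := fun μ hμ ↦ by
    by_contra h
    exact hμ (Finset.mem_insert_of_mem (hfin.mem_toFinset.mpr h))
  set D := n + T.sup (fun μ ↦ (P μ).natDegree) + 1 with D_eq
  have hD : ∀ μ, (P μ).natDegree < D := fun μ ↦ by
    by_cases hμ : μ ∈ T
    · have := Finset.le_sup (f := fun μ ↦ (P μ).natDegree) hμ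
      omega
    · rw [hPT μ hμ, Polynomial.natDegree_zero]
      omega
  have hsum : ∀ t : ℕ, (restrictedPartition n a t : ℂ) =
      ∑ μ ∈ T, (P μ).eval (t : ℂ) * μ ^ t := fun t ↦ by
    rw [hdecomp t]
    refine finsum_eq_sum_of_support_subset _ fun μ hμ ↦ ?_
    by_contra h
    exact hμ (by simp [hPT μ h])
  have hcoeff := prod_mul_coeff_mul_factorial n a ha P T D hD (Finset.mem_insert_self _ _) hsum
  have hdeg : (P 1).natDegree < n := by
    refine Nat.lt_of_le_pred hn (Polynomial.natDegree_le_iff_coeff_eq_zero.mpr fun j hj ↦ ?_)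
    have hj : n ≤ j := Nat.le_of_pred_lt hj
    by_cases hjD : j < D
    · have h := hcoeff j hjD
      rw [coeff_X_pow_mul', if_neg (by omega)] at h
      have hf : (j.factorial : ℂ) ≠ 0 := by exact_mod_cast j.factorial_ne_zero
      simpa [ha', hf] using h
    · exact Polynomial.coeff_eq_zero_of_natDegree_lt ((hD 1).trans_le (not_lt.mp hjD))
  rw [Polynomial.eval_eq_sum_range' hdeg, ← Finset.sum_range_reflect, Finset.mul_sum]
  refine Finset.sum_congr rfl fun m hm ↦ ?_
  rw [Finset.mem_range] at hm
  have h := hcoeff (n - 1 - m) (by omega)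
  rw [coeff_X_pow_mul', if_pos (by omega), show D - 1 - (n - 1 - m) + n - D = m by omega,
    coeff_prod_rescale_bernoulliPowerSeries] at h
  have hf : ((n - 1 - m).factorial : ℂ) ≠ 0 := by exact_mod_cast (n - 1 - m).factorial_ne_zero
  field_simp
  linear_combination (t : ℂ) ^ (n - 1 - m) * h
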